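/- arXiv:0901.2967 — 6 statements merged into one kernel-verified Lean document; each statement's English description precedes it below -/
import Mathlib

section
/- Phragmén–Lindelöf principle for circular cones: Let α > 1/2 and let f be a slice regular function on the circular cone C(π/α), continuous up to the boundary, whose order ρ satisfies ρ < α. If there exists M ≥ 0 such that |f(q)| ≤ M for all q ∈ ∂C(π/α), then |f(q)| ≤ M for all q ∈ C(π/α). -/
open scoped Quaternion

/-- The sphere of imaginary units in the quaternions. -/
def qSphere : Set ℍ[ℝ] := {q : ℍ[ℝ] | q.re = 0 ∧ ‖q‖ = 1}

/-- The point of the slice `L_I = ℝ + ℝI` corresponding to `z = x + iy ∈ ℂ`. -/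
noncomputable def toSlice (I : ℍ[ℝ]) (z : ℂ) : ℍ[ℝ] := (z.re : ℍ[ℝ]) + z.im • I

/-- `f` is slice regular on `Ω`: for each imaginary unit `I`, the restriction of `f` to
`Ω ∩ L_I`, read through the parametrization `toSlice I : ℂ → L_I`, is real differentiable
and satisfies the Cauchy–Riemann equation `∂f/∂x + I ∂f/∂y = 0`. -/
def SliceRegularOn (f : ℍ[ℝ] → ℍ[ℝ]) (Ω : Set ℍ[ℝ]) : Prop :=
  ∀ I ∈ qSphere, ∀ z : ℂ, toSlice I z ∈ Ω →
    ∃ D : ℂ →L[ℝ] ℍ[ℝ],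
      HasFDerivWithinAt (fun w => f (toSlice I w)) D (toSlice I ⁻¹' Ω) z ∧
      D 1 + I * D Complex.I = 0

/-- A slice domain: a domain meeting the real axis all of whose slices are domains. -/
def IsSliceDomain (Ω : Set ℍ[ℝ]) : Prop :=
  IsOpen Ω ∧ IsConnected Ω ∧ (∃ x : ℝ, (x : ℍ[ℝ]) ∈ Ω) ∧
  ∀ I ∈ qSphere, IsConnected (toSlice I ⁻¹' Ω)

/-- `cos θ + I sin θ`. -/
noncomputable def expI (I : ℍ[ℝ]) (θ : ℝ) : ℍ[ℝ] := (Real.cos θ : ℍ[ℝ]) + Real.sin θ • I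

/-- The circular cone of opening `φ` around the positive real axis. -/
def circularCone (φ : ℝ) : Set ℍ[ℝ] :=
  {q : ℍ[ℝ] | ∃ r θ : ℝ, ∃ I ∈ qSphere, 0 < r ∧ |θ| < φ / 2 ∧ q = r • expI I θ}

/-- `M_f(r)`: the maximum of `‖f‖` on the closure of `Ω` intersected with the sphere of radius `r`. -/
noncomputable def maxMod (f : ℍ[ℝ] → ℍ[ℝ]) (Ω : Set ℍ[ℝ]) (r : ℝ) : ℝ :=
  sSup ((fun q => ‖f q‖) '' (closure Ω ∩ Metric.sphere (0 : ℍ[ℝ]) r))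

/-- The order of a slice regular function. -/
noncomputable def growthOrder (f : ℍ[ℝ] → ℍ[ℝ]) (Ω : Set ℍ[ℝ]) : EReal :=
  Filter.limsup (fun r : ℝ =>
    ((max 0 (Real.log (max 0 (Real.log (maxMod f Ω r)))) / Real.log r : ℝ) : EReal))
    Filter.atTop

/-- The type of a slice regular function of order `ρ`. -/
noncomputable def growthType (f : ℍ[ℝ] → ℍ[ℝ]) (Ω : Set ℍ[ℝ]) (ρ : ℝ) : EReal :=
  Filter.limsup (fun r : ℝ => ((max 0 (Real.log (maxMod f Ω r)) / r ^ ρ : ℝ) : EReal))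
    Filter.atTop

/-- The angle of opening `φ` bisected by the half line of argument `ζ` in the slice `L_I`. -/
def angleSet (I : ℍ[ℝ]) (ζ φ : ℝ) : Set ℍ[ℝ] :=
  {q : ℍ[ℝ] | ∃ r θ : ℝ, 0 < r ∧ |θ| < φ / 2 ∧ q = r • expI I (ζ + θ)}

/-- The real affine line through `p` with direction `d`. -/
def lineSet (p d : ℍ[ℝ]) : Set ℍ[ℝ] := {q : ℍ[ℝ] | ∃ t : ℝ, q = p + t • d}

/-- `f` is slice preserving: it maps each slice into itself. -/
def SlicePreservingOn (f : ℍ[ℝ] → ℍ[ℝ]) (Ω : Set ℍ[ℝ]) : Prop :=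
  ∀ I ∈ qSphere, ∀ q ∈ Ω ∩ Set.range (toSlice I), f q ∈ Set.range (toSlice I)

/-- The principal quaternionic logarithm. -/
noncomputable def QLog (q : ℍ[ℝ]) : ℍ[ℝ] :=
  (Real.log ‖q‖ : ℍ[ℝ]) + Real.arccos (q.re / ‖q‖) • (‖q.im‖⁻¹ • q.im)

theorem mul_self_of_mem_qSphere {I : ℍ[ℝ]} (hI : I ∈ qSphere) : I * I = -1 := by
  obtain ⟨hre, hnorm⟩ := hI
  have hstar : star I = -I := by
    ext <;> simp [hre]
  have h := Quaternion.self_mul_star I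
  rw [hstar, Quaternion.normSq_eq_norm_mul_self, hnorm] at h
  rw [mul_neg] at h
  rw [eq_neg_iff_add_eq_zero, ← neg_eq_zero, neg_add, h]
  simp

/-- The embedding of `ℂ` onto the slice `L_I`, as an algebra homomorphism. -/
noncomputable def sliceHom {I : ℍ[ℝ]} (hI : I ∈ qSphere) : ℂ →ₐ[ℝ] ℍ[ℝ] :=
  Complex.lift ⟨I, mul_self_of_mem_qSphere hI⟩

theorem sliceHom_apply {I : ℍ[ℝ]} (hI : I ∈ qSphere) (z : ℂ) : sliceHom hI z = toSlice I z := by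
  simp [sliceHom, toSlice, Complex.liftAux_apply]

theorem norm_toSlice {I : ℍ[ℝ]} (hI : I ∈ qSphere) (z : ℂ) : ‖toSlice I z‖ = ‖z‖ := by
  have hsq : ‖toSlice I z‖ ^ 2 = ‖z‖ ^ 2 := by
    have hn : Quaternion.normSq I = 1 := by
      rw [Quaternion.normSq_eq_norm_mul_self, hI.2, one_mul]
    rw [sq, ← Quaternion.normSq_eq_norm_mul_self, Complex.sq_norm, Complex.normSq_apply]
    rw [Quaternion.normSq_def'] at hn ⊢
    simp [toSlice, hI.1] at hn ⊢
    linear_combination z.im ^ 2 * hn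
  exact (sq_eq_sq₀ (norm_nonneg _) (norm_nonneg _)).1 hsq

/-- The complex normed space structure on `ℍ` given by left multiplication by the slice `L_I`. -/
noncomputable abbrev sliceNormedSpace {I : ℍ[ℝ]} (hI : I ∈ qSphere) : NormedSpace ℂ ℍ[ℝ] :=
  { Module.compHom ℍ[ℝ] (sliceHom hI).toRingHom with
    norm_smul_le := fun z q => by
      change ‖sliceHom hI z * q‖ ≤ _
      rw [norm_mul, sliceHom_apply, norm_toSlice hI] }

theorem differentiableWithinAt_complex_of_real {E : Type*} [NormedAddCommGroup E]
    [NormedSpace ℂ E] [NormedSpace ℝ E] [IsScalarTower ℝ ℂ E] {g : ℂ → E} {D : ℂ →L[ℝ] E}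
    {s : Set ℂ} {z : ℂ} (hg : HasFDerivWithinAt g D s z) (hD : D Complex.I = Complex.I • D 1) :
    DifferentiableWithinAt ℂ g s z := by
  refine (hg.of_restrictScalars ℝ
    (f' := ContinuousLinearMap.toSpanSingleton ℂ (D 1)) ?_).differentiableWithinAt
  ext w
  have hw : w = w.re • (1 : ℂ) + w.im • Complex.I := by
    simp [Complex.re_add_im]
  change w • D 1 = D w
  conv_rhs => rw [hw, map_add, map_smul, map_smul, hD]
  conv_lhs => rw [hw, add_smul, smul_assoc, smul_assoc, one_smul]

theorem toSlice_exp (I : ℍ[ℝ]) (w : ℂ) :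
    toSlice I (Complex.exp w) = Real.exp w.re • expI I w.im := by
  simp [toSlice, expI, Complex.exp_re, Complex.exp_im, smul_add, mul_smul,
    ← Quaternion.coe_mul_eq_smul]

theorem continuous_toSlice (I : ℍ[ℝ]) : Continuous (toSlice I) := by
  unfold toSlice
  exact (Quaternion.continuous_coe.comp Complex.continuous_re).add
    (Complex.continuous_im.smul continuous_const)

theorem norm_toSlice_exp {I : ℍ[ℝ]} (hI : I ∈ qSphere) (w : ℂ) :
    ‖toSlice I (Complex.exp w)‖ = Real.exp w.re := by
  rw [norm_toSlice hI, Complex.norm_exp]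

theorem toSlice_exp_mem_cone {I : ℍ[ℝ]} (hI : I ∈ qSphere) {φ : ℝ} {w : ℂ}
    (hw : w.im ∈ Set.Ioo (-(φ / 2)) (φ / 2)) : toSlice I (Complex.exp w) ∈ circularCone φ :=
  ⟨Real.exp w.re, w.im, I, hI, Real.exp_pos _, abs_lt.2 hw, toSlice_exp I w⟩

theorem exists_eq_toSlice_exp {φ : ℝ} {q : ℍ[ℝ]} (hq : q ∈ circularCone φ) :
    ∃ I ∈ qSphere, ∃ w : ℂ, w.im ∈ Set.Ioo (-(φ / 2)) (φ / 2) ∧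
      q = toSlice I (Complex.exp w) := by
  obtain ⟨r, θ, I, hI, hr, hθ, rfl⟩ := hq
  refine ⟨I, hI, ⟨Real.log r, θ⟩, abs_lt.1 hθ, ?_⟩
  rw [toSlice_exp]
  simp [Real.exp_log hr]

theorem re_toSlice_exp {I : ℍ[ℝ]} (hI : I ∈ qSphere) (w : ℂ) :
    (toSlice I (Complex.exp w)).re = Real.exp w.re * Real.cos w.im := by
  simp [toSlice, hI.1, Complex.exp_re]

theorem toSlice_exp_notMem_cone {I : ℍ[ℝ]} (hI : I ∈ qSphere) {φ : ℝ} (hφ : φ / 2 ≤ Real.pi)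
    {w : ℂ} (hw : |w.im| = φ / 2) : toSlice I (Complex.exp w) ∉ circularCone φ := by
  intro hmem
  obtain ⟨J, hJ, v, hv, heq⟩ := exists_eq_toSlice_exp hmem
  have hnorm := congrArg norm heq
  rw [norm_toSlice_exp hI, norm_toSlice_exp hJ] at hnorm
  have hre := congrArg (fun q : ℍ[ℝ] => q.re) heq
  simp only [re_toSlice_exp hI, re_toSlice_exp hJ, hnorm] at hre
  have hcos := mul_left_cancel₀ (Real.exp_pos _).ne' hre
  have hlt : Real.cos |w.im| < Real.cos |v.im| :=
    Real.cos_lt_cos_of_nonneg_of_le_pi (abs_nonneg _) (hw.trans_le hφ) (hw ▸ abs_lt.2 hv)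
  rw [Real.cos_abs, Real.cos_abs] at hlt
  exact hlt.ne hcos

theorem norm_le_maxMod {f : ℍ[ℝ] → ℍ[ℝ]} {Ω : Set ℍ[ℝ]} (hf : ContinuousOn f (closure Ω))
    {q : ℍ[ℝ]} (hq : q ∈ closure Ω) : ‖f q‖ ≤ maxMod f Ω ‖q‖ := by
  have hcomp : IsCompact (closure Ω ∩ Metric.sphere (0 : ℍ[ℝ]) ‖q‖) :=
    (isCompact_sphere _ _).inter_left isClosed_closure
  exact le_csSup (hcomp.image_of_continuousOn
    (hf.norm.mono Set.inter_subset_left)).bddAbove ⟨q, ⟨hq, by simp⟩, rfl⟩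

theorem eventually_maxMod_le_of_growthOrder_lt {f : ℍ[ℝ] → ℍ[ℝ]} {Ω : Set ℍ[ℝ]} {c : ℝ}
    (h : growthOrder f Ω < c) :
    ∀ᶠ r in Filter.atTop, maxMod f Ω r ≤ Real.exp (r ^ c) := by
  filter_upwards [Filter.eventually_lt_of_limsup_lt h, Filter.eventually_gt_atTop 1] with r hr hr1
  have hr0 : 0 < r := one_pos.trans hr1
  rw [EReal.coe_lt_coe_iff, div_lt_iff₀ (Real.log_pos hr1)] at hr
  rcases le_or_gt (maxMod f Ω r) 0 with hm | hm
  · exact hm.trans (Real.exp_pos _).le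
  refine (Real.log_le_iff_le_exp hm).1 ?_
  rcases le_or_gt (Real.log (maxMod f Ω r)) 0 with hl | hl
  · exact hl.trans (Real.rpow_nonneg hr0.le _)
  have hlog := (le_max_right _ _).trans hr.le
  rw [max_eq_right hl.le] at hlog
  rwa [Real.rpow_def_of_pos hr0, mul_comm, ← Real.log_le_iff_le_exp hl]

theorem exists_norm_le_of_growthOrder_lt {f : ℍ[ℝ] → ℍ[ℝ]} {Ω : Set ℍ[ℝ]}
    (hf : ContinuousOn f (closure Ω)) {c : ℝ} (h : growthOrder f Ω < c) :
    ∃ K : ℝ, ∀ q ∈ closure Ω, 0 < ‖q‖ →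
      ‖f q‖ ≤ K * Real.exp (Real.exp (c * |Real.log ‖q‖|)) := by
  obtain ⟨R, hR⟩ := Filter.eventually_atTop.1
    ((eventually_maxMod_le_of_growthOrder_lt h).and (Filter.eventually_ge_atTop 1))
  have hcomp : IsCompact (closure Ω ∩ Metric.closedBall (0 : ℍ[ℝ]) R) :=
    (isCompact_closedBall _ _).inter_left isClosed_closure
  obtain ⟨K, hK⟩ := (hcomp.image_of_continuousOn
    (hf.norm.mono Set.inter_subset_left)).bddAbove
  refine ⟨max K 1, fun q hq hq0 => ?_⟩
  have hone : 1 ≤ Real.exp (Real.exp (c * |Real.log ‖q‖|)) :=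
    Real.one_le_exp (Real.exp_pos _).le
  have hmax : 1 ≤ max K 1 := le_max_right _ _
  rcases le_total ‖q‖ R with hqR | hqR
  · calc ‖f q‖ ≤ K := hK ⟨q, ⟨hq, by simpa using hqR⟩, rfl⟩
      _ ≤ max K 1 := le_max_left _ _
      _ ≤ _ := le_mul_of_one_le_right (zero_le_one.trans hmax) hone
  · obtain ⟨hle, hq1⟩ := hR ‖q‖ hqR
    calc ‖f q‖ ≤ Real.exp (‖q‖ ^ c) := (norm_le_maxMod hf hq).trans hle
      _ = Real.exp (Real.exp (c * |Real.log ‖q‖|)) := by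
        rw [abs_of_nonneg (Real.log_nonneg hq1), Real.rpow_def_of_pos hq0, mul_comm]
      _ ≤ _ := le_mul_of_one_le_left (Real.exp_pos _).le hmax

/-- In the logarithmic coordinate, a slice regular function is holomorphic for the complex
structure given by left multiplication. -/
theorem differentiableOn_comp_toSlice_exp {f : ℍ[ℝ] → ℍ[ℝ]} {φ : ℝ}
    (hf : SliceRegularOn f (circularCone φ)) {I : ℍ[ℝ]} (hI : I ∈ qSphere) :
    letI := sliceNormedSpace hI
    DifferentiableOn ℂ (fun w => f (toSlice I (Complex.exp w)))
      (Complex.im ⁻¹' Set.Ioo (-(φ / 2)) (φ / 2)) := by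
  let hC : NormedSpace ℂ ℍ[ℝ] := sliceNormedSpace hI
  have : IsScalarTower ℝ ℂ ℍ[ℝ] := ⟨fun x z q => by
    change sliceHom hI (x • z) * q = x • (sliceHom hI z * q)
    rw [map_smul, smul_mul_assoc]⟩
  have hslice : DifferentiableOn ℂ (fun z => f (toSlice I z))
      (toSlice I ⁻¹' circularCone φ) := by
    intro z hz
    obtain ⟨D, hD, hCR⟩ := hf I hI z hz
    refine differentiableWithinAt_complex_of_real hD ?_
    change D Complex.I = sliceHom hI Complex.I * D 1
    rw [sliceHom_apply, eq_neg_of_add_eq_zero_left hCR, mul_neg, ← mul_assoc]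
    simp [toSlice, mul_self_of_mem_qSphere hI]
  exact hslice.comp Complex.differentiable_exp.differentiableOn
    fun w hw => toSlice_exp_mem_cone hI hw

/-- Phragmén–Lindelöf principle for circular cones. -/
theorem phragmen_lindelof_cone (α : ℝ) (hα : 1 / 2 < α)
    (f : ℍ[ℝ] → ℍ[ℝ])
    (hf : SliceRegularOn f (circularCone (Real.pi / α)))
    (hcont : ContinuousOn f (closure (circularCone (Real.pi / α))))
    (horder : growthOrder f (circularCone (Real.pi / α)) < (α : EReal))
    (M : ℝ) (hM : 0 ≤ M)
    (hbd : ∀ q ∈ frontier (circularCone (Real.pi / α)), ‖f q‖ ≤ M) :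
    ∀ q ∈ circularCone (Real.pi / α), ‖f q‖ ≤ M := by
  have hα0 : 0 < α := by linarith
  set φ := Real.pi / α with hφ
  have hφ0 : 0 < φ := div_pos Real.pi_pos hα0
  have hφpi : φ / 2 ≤ Real.pi := by
    rw [hφ, div_div, div_le_iff₀ (by positivity)]
    nlinarith [Real.pi_pos]
  intro q hq
  obtain ⟨I, hI, z, hz, rfl⟩ := exists_eq_toSlice_exp hq
  let hC : NormedSpace ℂ ℍ[ℝ] := sliceNormedSpace hI
  set S : Set ℂ := Complex.im ⁻¹' Set.Ioo (-(φ / 2)) (φ / 2) with hS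
  have hcts : Continuous fun w => toSlice I (Complex.exp w) :=
    (continuous_toSlice I).comp Complex.continuous_exp
  have hmaps : Set.MapsTo (fun w => toSlice I (Complex.exp w)) (closure S)
      (closure (circularCone φ)) :=
    Set.MapsTo.closure (fun w hw => toSlice_exp_mem_cone hI hw) hcts
  have hclosure : closure S = Complex.im ⁻¹' Set.Icc (-(φ / 2)) (φ / 2) := by
    rw [hS, Complex.closure_preimage_im, closure_Ioo (by linarith)]
  have hbdry : ∀ w : ℂ, |w.im| = φ / 2 → ‖f (toSlice I (Complex.exp w))‖ ≤ M := by
    refine fun w hw => hbd _ ⟨hmaps ?_, fun h => ?_⟩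
    · rw [hclosure]
      exact abs_le.1 hw.le
    · exact toSlice_exp_notMem_cone hI hφpi hw (interior_subset h)
  obtain ⟨c, hc, hcα⟩ := EReal.lt_iff_exists_real_btwn.1 horder
  obtain ⟨K, hK⟩ := exists_norm_le_of_growthOrder_lt hcont hc
  refine PhragmenLindelof.horizontal_strip (a := -(φ / 2)) (b := φ / 2)
    (f := fun w => f (toSlice I (Complex.exp w)))
    ⟨differentiableOn_comp_toSlice_exp hf hI, hcont.comp hcts.continuousOn hmaps⟩
    ⟨c, ?_, 1, ?_⟩ (fun w hw => hbdry w ?_) (fun w hw => hbdry w ?_) hz.1.le hz.2.le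
  · have : Real.pi / (φ / 2 - -(φ / 2)) = α := by
      rw [hφ]
      field_simp [Real.pi_ne_zero]
      norm_num
    rw [this]
    exact EReal.coe_lt_coe_iff.1 hcα
  · refine Asymptotics.IsBigO.of_bound K (Filter.eventually_inf_principal.2 ?_)
    refine Filter.Eventually.of_forall fun w hw => ?_
    have hpos : 0 < ‖toSlice I (Complex.exp w)‖ := by
      rw [norm_toSlice_exp hI]
      exact Real.exp_pos _
    have hbound := hK _ (hmaps (subset_closure hw)) hpos
    rw [norm_toSlice_exp hI, Real.log_exp] at hbound
    rwa [one_mul, Real.norm_eq_abs, Real.abs_exp]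
  · rw [hw, abs_neg, abs_of_pos (half_pos hφ0)]
  · rw [hw, abs_of_pos (half_pos hφ0)]
end

section
/- Let Ω be an open subset of ℍ such that for every I ∈ 𝕊 the slice Ω_I = Ω ∩ L_I is the angle {r e^{I(ζ_I + θ)} : r > 0, |θ| < φ_I/2} for some ζ_I ∈ ℝ and 0 < φ_I < 2π. If the maps I ↦ ζ_I and I ↦ φ_I can be chosen continuous on 𝕊, then Ω is automatically a slice domain; in particular, there exists J ∈ 𝕊 such that ζ_J = kπ for some integer k, so some slice Ω_J contains a real half-line. -/
open scoped Quaternion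

theorem neg_mem_qSphere {I : ℍ[ℝ]} (hI : I ∈ qSphere) : -I ∈ qSphere := by
  simpa [qSphere] using hI

theorem isConnected_qSphere : IsConnected qSphere := by
  let e : EuclideanSpace ℝ (Fin 3) →ₗ[ℝ] ℍ[ℝ] :=
    { toFun := fun v => ⟨0, v 0, v 1, v 2⟩
      map_add' := fun v w => Quaternion.ext _ _ (zero_add 0).symm rfl rfl rfl
      map_smul' := fun c v => Quaternion.ext _ _ (mul_zero c).symm rfl rfl rfl }
  have hnorm : ∀ v, ‖e v‖ = ‖v‖ := fun v => by
    rw [← sq_eq_sq₀ (norm_nonneg _) (norm_nonneg _), EuclideanSpace.norm_sq_eq, sq,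
      ← Quaternion.normSq_eq_norm_mul_self, Quaternion.normSq_def', Fin.sum_univ_three]
    change (0 : ℝ) ^ 2 + v 0 ^ 2 + v 1 ^ 2 + v 2 ^ 2 = _
    simp
  have himage : e '' Metric.sphere 0 1 = qSphere := by
    ext q
    constructor
    · rintro ⟨v, hv, rfl⟩
      exact ⟨rfl, by rw [hnorm]; simpa using hv⟩
    · rintro ⟨hre, hq⟩
      have heq : e !₂[q.imI, q.imJ, q.imK] = q :=
        Quaternion.ext _ _ hre.symm rfl rfl rfl
      exact ⟨_, by rw [mem_sphere_zero_iff_norm, ← hnorm, heq, hq], heq⟩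
  rw [← himage]
  refine (isConnected_sphere ?_ 0 zero_le_one).image e
    e.continuous_of_finiteDimensional.continuousOn
  rw [← Module.finrank_eq_rank, finrank_euclideanSpace_fin]
  norm_num

theorem toSlice_injective {I : ℍ[ℝ]} (hI : I ∈ qSphere) : Function.Injective (toSlice I) := by
  intro z w h
  have hre : z.re = w.re := by
    have := congrArg (fun q : ℍ[ℝ] => q.re) h
    simpa [toSlice, hI.1] using this
  have hI0 : I ≠ 0 := by
    rintro rfl
    simpa using hI.2
  refine Complex.ext hre ?_
  simp only [toSlice, hre, add_right_inj] at h
  exact smul_left_injective ℝ hI0 h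

theorem toSlice_neg (I : ℍ[ℝ]) (z : ℂ) : toSlice (-I) z = toSlice I (starRingEnd ℂ z) := by
  simp [toSlice]

theorem range_toSlice_neg (I : ℍ[ℝ]) : Set.range (toSlice (-I)) = Set.range (toSlice I) := by
  have : toSlice (-I) = toSlice I ∘ starRingEnd ℂ := funext (toSlice_neg I)
  rw [this, (Function.Involutive.surjective Complex.conj_conj).range_comp]

theorem exists_mem_range_toSlice (q : ℍ[ℝ]) : ∃ I ∈ qSphere, q ∈ Set.range (toSlice I) := by
  by_cases h : q.im = 0
  · obtain ⟨I, hI⟩ := isConnected_qSphere.nonempty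
    refine ⟨I, hI, (q.re : ℂ), ?_⟩
    conv_rhs => rw [← Quaternion.re_add_im q, h]
    simp [toSlice]
  · have hn : ‖q.im‖ ≠ 0 := norm_ne_zero_iff.mpr h
    refine ⟨‖q.im‖⁻¹ • q.im, ⟨by simp, ?_⟩, ⟨q.re, ‖q.im‖⟩, ?_⟩
    · rw [norm_smul, norm_inv, norm_norm, inv_mul_cancel₀ hn]
    · simp only [toSlice, smul_smul, mul_inv_cancel₀ hn, one_smul]
      exact Quaternion.re_add_im q

theorem smul_expI (I : ℍ[ℝ]) (r t : ℝ) :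
    r • expI I t = toSlice I ⟨r * Real.cos t, r * Real.sin t⟩ := by
  simp [expI, toSlice, ← Quaternion.coe_mul_eq_smul, mul_assoc]

theorem angleSet_neg (I : ℍ[ℝ]) (ζ φ : ℝ) : angleSet (-I) ζ φ = angleSet I (-ζ) φ := by
  have hexp : ∀ t, expI (-I) t = expI I (-t) := fun t => by simp [expI]
  ext q
  constructor <;> rintro ⟨r, θ, hr, hθ, rfl⟩
  · exact ⟨r, -θ, hr, by rwa [abs_neg], by rw [hexp, neg_add]⟩
  · exact ⟨r, -θ, hr, by rwa [abs_neg], by rw [hexp, neg_add, neg_neg]⟩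

theorem expI_mem_angleSet {I : ℍ[ℝ]} {ζ φ θ : ℝ} (hθ : |θ| < φ / 2) :
    expI I (ζ + θ) ∈ angleSet I ζ φ :=
  ⟨1, θ, one_pos, hθ, (one_smul ℝ _).symm⟩

theorem exists_of_expI_mem_angleSet {I : ℍ[ℝ]} (hI : I ∈ qSphere) {ζ φ t : ℝ}
    (h : expI I t ∈ angleSet I ζ φ) : ∃ k : ℤ, |t - ζ - 2 * Real.pi * k| < φ / 2 := by
  obtain ⟨r, θ, hr, hθ, heq⟩ := h
  rw [← one_smul ℝ (expI I t), smul_expI, smul_expI] at heq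
  have hz := toSlice_injective hI heq
  simp only [Complex.mk.injEq, one_mul] at hz
  obtain ⟨hc, hs⟩ := hz
  have hr1 : r = 1 := by
    have h1 := Real.cos_sq_add_sin_sq t
    have h2 := Real.cos_sq_add_sin_sq (ζ + θ)
    rw [hc, hs] at h1
    have : r ^ 2 = 1 := by linear_combination h1 - r ^ 2 * h2
    exact (pow_eq_one_iff_of_nonneg hr.le two_ne_zero).mp this
  rw [hr1, one_mul] at hc hs
  obtain ⟨k, hk⟩ := Real.Angle.angle_eq_iff_two_pi_dvd_sub.mp (Real.Angle.cos_sin_inj hc hs)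
  refine ⟨k, ?_⟩
  rwa [← hk, show t - ζ - (t - (ζ + θ)) = θ by ring]

theorem exists_add_abs_le_of_angleSet_subset {I : ℍ[ℝ]} (hI : I ∈ qSphere) {ζ φ ζ' φ' : ℝ}
    (hφ : 0 < φ) (hφ' : φ' < 2 * Real.pi) (h : angleSet I ζ φ ⊆ angleSet I ζ' φ') :
    ∃ k : ℤ, φ / 2 + |ζ - ζ' - 2 * Real.pi * k| ≤ φ' / 2 := by
  have hmem : ∀ θ, |θ| < φ / 2 → ∃ k : ℤ, |ζ + θ - ζ' - 2 * Real.pi * k| < φ' / 2 :=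
    fun θ hθ => exists_of_expI_mem_angleSet hI (h (expI_mem_angleSet hθ))
  obtain ⟨k, hk⟩ := hmem 0 (by simpa using hφ)
  rw [add_zero, abs_lt] at hk
  have hpi := Real.pi_pos
  have hno : ∀ m : ℤ, 0 < 2 * Real.pi * m → 2 * Real.pi * m < 2 * Real.pi → False := by
    intro m h0 h1
    have h0' : (0 : ℝ) < m := by
      by_contra! hm
      nlinarith
    have h1' : (m : ℝ) < 1 := by
      by_contra! hm
      nlinarith
    have : 0 < m := by exact_mod_cast h0'
    have : m < 1 := by exact_mod_cast h1'
    omega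
  have hright : φ / 2 ≤ φ' / 2 - (ζ - ζ' - 2 * Real.pi * k) := by
    by_contra! hlt
    obtain ⟨m, hm⟩ := hmem (φ' / 2 - (ζ - ζ' - 2 * Real.pi * k))
      (abs_lt.mpr ⟨by linarith, hlt⟩)
    rw [abs_lt] at hm
    refine hno (m - k) ?_ ?_ <;> push_cast <;> linarith
  have hleft : φ / 2 ≤ φ' / 2 + (ζ - ζ' - 2 * Real.pi * k) := by
    by_contra! hlt
    obtain ⟨m, hm⟩ := hmem (-(φ' / 2 + (ζ - ζ' - 2 * Real.pi * k)))
      (abs_lt.mpr ⟨by linarith, by linarith⟩)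
    rw [abs_lt] at hm
    refine hno (k - m) ?_ ?_ <;> push_cast <;> linarith
  refine ⟨k, ?_⟩
  have := abs_le.mpr (⟨by linarith, by linarith⟩ :
    -(φ' / 2 - φ / 2) ≤ ζ - ζ' - 2 * Real.pi * k ∧ _ ≤ φ' / 2 - φ / 2)
  linarith

theorem exists_sub_eq_of_angleSet_eq {I : ℍ[ℝ]} (hI : I ∈ qSphere) {ζ φ ζ' φ' : ℝ}
    (hφ : 0 < φ ∧ φ < 2 * Real.pi) (hφ' : 0 < φ' ∧ φ' < 2 * Real.pi)
    (h : angleSet I ζ φ = angleSet I ζ' φ') : ∃ k : ℤ, ζ - ζ' = 2 * Real.pi * k := by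
  obtain ⟨k, hk⟩ := exists_add_abs_le_of_angleSet_subset hI hφ.1 hφ'.2 h.subset
  obtain ⟨m, hm⟩ := exists_add_abs_le_of_angleSet_subset hI hφ'.1 hφ.2 h.superset
  refine ⟨k, ?_⟩
  have h0 : |ζ - ζ' - 2 * Real.pi * k| = 0 :=
    le_antisymm (by linarith [abs_nonneg (ζ' - ζ - 2 * Real.pi * m)]) (abs_nonneg _)
  linarith [abs_eq_zero.mp h0]

theorem isConnected_toSlice_preimage {Ω : Set ℍ[ℝ]} {I : ℍ[ℝ]} (hI : I ∈ qSphere) {ζ φ : ℝ}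
    (hφ : 0 < φ) (h : Ω ∩ Set.range (toSlice I) = angleSet I ζ φ) :
    IsConnected (toSlice I ⁻¹' Ω) := by
  have himage : toSlice I ⁻¹' Ω =
      (fun p : ℝ × ℝ => (⟨p.1 * Real.cos (ζ + p.2), p.1 * Real.sin (ζ + p.2)⟩ : ℂ)) ''
        (Set.Ioi 0 ×ˢ Set.Ioo (-(φ / 2)) (φ / 2)) := by
    rw [← Set.preimage_inter_range, h]
    ext z
    constructor
    · rintro ⟨r, θ, hr, hθ, heq⟩
      rw [smul_expI] at heq
      exact ⟨(r, θ), ⟨hr, abs_lt.mp hθ⟩, (toSlice_injective hI heq).symm⟩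
    · rintro ⟨⟨r, θ⟩, ⟨hr, hθ⟩, rfl⟩
      exact ⟨r, θ, hr, abs_lt.mpr hθ, (smul_expI I r _).symm⟩
  rw [himage]
  refine (isConnected_Ioi.prod (isConnected_Ioo (by linarith))).image _ (Continuous.continuousOn ?_)
  refine Complex.equivRealProdCLM.symm.continuous.comp
    (f := fun p : ℝ × ℝ => (p.1 * Real.cos (ζ + p.2), p.1 * Real.sin (ζ + p.2))) ?_
  fun_prop

theorem exists_eq_int_mul_pi {ζ : ℍ[ℝ] → ℝ} (hζ : ContinuousOn ζ qSphere)
    (h : ∀ I ∈ qSphere, ∃ k : ℤ, ζ I + ζ (-I) = 2 * Real.pi * k) :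
    ∃ J ∈ qSphere, ∃ k : ℤ, ζ J = k * Real.pi := by
  obtain ⟨I₀, hI₀⟩ := isConnected_qSphere.nonempty
  obtain ⟨k, hk⟩ := h I₀ hI₀
  have hzero : ∃ J ∈ qSphere, ζ J = k * Real.pi := by
    rcases le_total (ζ I₀) (k * Real.pi) with hle | hle
    · exact isConnected_qSphere.isPreconnected.intermediate_value hI₀ (neg_mem_qSphere hI₀) hζ
        ⟨hle, by linarith⟩
    · exact isConnected_qSphere.isPreconnected.intermediate_value (neg_mem_qSphere hI₀) hI₀ hζ
        ⟨by linarith, hle⟩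
  obtain ⟨J, hJ, hJeq⟩ := hzero
  exact ⟨J, hJ, k, hJeq⟩

/-- An open set all of whose slices are angles, with continuously varying vertex angle data,
is automatically a slice domain; in particular some slice is bisected by a real half-line. -/
theorem slice_domain_of_angular_slices
    (Ω : Set ℍ[ℝ]) (hΩ : IsOpen Ω)
    (ζ φ : ℍ[ℝ] → ℝ)
    (hφ : ∀ I ∈ qSphere, 0 < φ I ∧ φ I < 2 * Real.pi)
    (hangle : ∀ I ∈ qSphere, Ω ∩ Set.range (toSlice I) = angleSet I (ζ I) (φ I))
    (hζcont : ContinuousOn ζ qSphere) (hφcont : ContinuousOn φ qSphere) :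
    IsSliceDomain Ω ∧ ∃ J ∈ qSphere, ∃ k : ℤ, ζ J = k * Real.pi := by
  have hJ : ∃ J ∈ qSphere, ∃ k : ℤ, ζ J = k * Real.pi := by
    refine exists_eq_int_mul_pi hζcont fun I hI => ?_
    have hI' := neg_mem_qSphere hI
    have heq : angleSet I (ζ I) (φ I) = angleSet I (-ζ (-I)) (φ (-I)) := by
      rw [← angleSet_neg, ← hangle I hI, ← hangle (-I) hI', range_toSlice_neg]
    simpa using exists_sub_eq_of_angleSet_eq hI (hφ I hI) (hφ (-I) hI') heq
  refine ⟨?_, hJ⟩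
  have hslice : ∀ I ∈ qSphere, IsConnected (toSlice I ⁻¹' Ω) := fun I hI =>
    isConnected_toSlice_preimage hI (hφ I hI).1 (hangle I hI)
  obtain ⟨x, hx⟩ : ∃ x : ℝ, (x : ℍ[ℝ]) ∈ Ω := by
    obtain ⟨J, hJ, k, hk⟩ := hJ
    refine ⟨Real.cos (ζ J), ?_⟩
    have hmem := expI_mem_angleSet (I := J) (ζ := ζ J) (θ := 0) (φ := φ J)
      (by simpa using (hφ J hJ).1)
    rw [← hangle J hJ] at hmem
    simpa [expI, hk, Real.sin_int_mul_pi] using hmem.1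
  refine ⟨hΩ, ⟨⟨x, hx⟩, isPreconnected_of_forall (x : ℍ[ℝ]) fun q hq => ?_⟩, ⟨x, hx⟩, hslice⟩
  obtain ⟨I, hI, z, rfl⟩ := exists_mem_range_toSlice q
  have hxI : toSlice I x = x := by simp [toSlice]
  refine ⟨toSlice I '' (toSlice I ⁻¹' Ω), Set.image_preimage_subset _ _,
    ⟨x, by rwa [Set.mem_preimage, hxI], hxI⟩, ⟨z, hq, rfl⟩, ?_⟩
  exact (hslice I hI).isPreconnected.image _ (continuous_toSlice I).continuousOn
end

section
/- Splitting Lemma: If f is a slice regular function on an open set Ω ⊆ ℍ, then for every I ∈ 𝕊 and every J ∈ 𝕊 with J perpendicular to I, there exist two holomorphic functions F, G : Ω_I → L_I such that f_I(z) = F(z) + G(z)J for all z ∈ Ω_I (here L_I is identified with ℂ via x + yI ↦ x + yi, and F, G are holomorphic with respect to this complex structure). -/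
open scoped Quaternion

/-- The orthogonal projection `ℍ → L_I`, read through the identification `toSlice I : ℂ ≃ L_I`. -/
noncomputable def sliceProj (I : ℍ[ℝ]) : ℍ[ℝ] →ₗ[ℝ] ℂ where
  toFun q := ⟨q.re, -(I * q).re⟩
  map_add' p q := by
    apply Complex.ext <;> simp [mul_add]
    ring
  map_smul' r q := by
    apply Complex.ext <;> simp
    ring

theorem mul_eq_neg_mul_of_perp {I J : ℍ[ℝ]} (hI : I.re = 0) (hJ : J.re = 0)
    (hperp : (I * star J).re = 0) : J * I = -(I * J) := by
  simp [hI, hJ] at hperp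
  ext <;> simp [hI, hJ] <;> linarith

theorem sliceProj_mul_left {I : ℍ[ℝ]} (hI : I ∈ qSphere) (q : ℍ[ℝ]) :
    sliceProj I (I * q) = Complex.I * sliceProj I q := by
  apply Complex.ext
  · simp [sliceProj]
  · simp only [sliceProj, LinearMap.coe_mk, AddHom.coe_mk, ← mul_assoc,
      mul_self_of_mem_qSphere hI]
    simp

theorem two_smul_toSlice_sliceProj {I : ℍ[ℝ]} (hI : I ∈ qSphere) (q : ℍ[ℝ]) :
    (2 : ℝ) • toSlice I (sliceProj I q) = q - I * q * I := by
  have h := congrArg QuaternionAlgebra.re (mul_self_of_mem_qSphere hI)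
  have h0 := hI.1
  simp [h0] at h
  ext <;> simp [toSlice, sliceProj, h0]
  · linear_combination q.re * h
  · linear_combination (-q.imI) * h
  · linear_combination (-q.imJ) * h
  · linear_combination (-q.imK) * h

theorem toSlice_sliceProj_add_mul {I J : ℍ[ℝ]} (hI : I ∈ qSphere) (hJ : J ∈ qSphere)
    (hperp : (I * star J).re = 0) (q : ℍ[ℝ]) :
    q = toSlice I (sliceProj I q) + toSlice I (sliceProj I (q * -J)) * J := by
  apply smul_right_injective ℍ[ℝ] (two_ne_zero (α := ℝ))
  have hJJ := mul_self_of_mem_qSphere hJ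
  have hJI := mul_eq_neg_mul_of_perp hI.1 hJ.1 hperp
  have hJIJ : J * I * J = I := by rw [hJI, neg_mul, mul_assoc, hJJ]; simp
  have hcross : I * (q * -J) * I * J = -(I * q * I) := by
    calc I * (q * -J) * I * J = -(I * q * (J * I * J)) := by noncomm_ring
      _ = _ := by rw [hJIJ]
  have hsq : q * -J * J = q := by
    rw [mul_assoc, neg_mul, hJJ]; simp
  simp only [smul_add, ← smul_mul_assoc, two_smul_toSlice_sliceProj hI]
  rw [sub_mul, hcross, hsq, two_smul]
  abel

/-- A real derivative satisfying the Cauchy–Riemann equation of `L_I` becomes complex linear after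
composition with a real linear map intertwining left multiplication by `I` and by `i`. -/
theorem differentiableWithinAt_comp_of_cauchyRiemann {I : ℍ[ℝ]} (hI : I ∈ qSphere)
    (L : ℍ[ℝ] →L[ℝ] ℂ) (hL : ∀ q, L (I * q) = Complex.I * L q)
    {g : ℂ → ℍ[ℝ]} {D : ℂ →L[ℝ] ℍ[ℝ]} {s : Set ℂ} {z : ℂ}
    (hg : HasFDerivWithinAt g D s z) (hD : D 1 + I * D Complex.I = 0) :
    DifferentiableWithinAt ℂ (fun w => L (g w)) s z := by
  have hDI : D Complex.I = I * D 1 := by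
    rw [eq_neg_of_add_eq_zero_left hD, mul_neg, ← mul_assoc, mul_self_of_mem_qSphere hI]
    simp
  have hcomp : HasFDerivWithinAt (fun w => L (g w)) (L.comp D) s z :=
    L.hasFDerivAt.comp_hasFDerivWithinAt z hg
  refine (HasFDerivWithinAt.of_restrictScalars ℝ hcomp
    (f' := ContinuousLinearMap.toSpanSingleton ℂ (L (D 1))) ?_).differentiableWithinAt
  ext w
  have hw : w = w.re • (1 : ℂ) + w.im • Complex.I := by
    apply Complex.ext <;> simp
  have hDw : L (D w) = w.re • L (D 1) + w.im • (Complex.I * L (D 1)) := by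
    conv_lhs => rw [hw]
    rw [map_add, map_smul, map_smul, hDI, map_add, map_smul, map_smul, hL]
  simp only [ContinuousLinearMap.coe_restrictScalars', ContinuousLinearMap.comp_apply,
    ContinuousLinearMap.toSpanSingleton_apply, hDw]
  simp only [Complex.real_smul, smul_eq_mul] at hw ⊢
  linear_combination L (D 1) * hw

/-- Splitting Lemma. -/
theorem splitting_lemma
    (Ω : Set ℍ[ℝ]) (hΩ : IsOpen Ω)
    (f : ℍ[ℝ] → ℍ[ℝ]) (hf : SliceRegularOn f Ω)
    (I : ℍ[ℝ]) (hI : I ∈ qSphere) (J : ℍ[ℝ]) (hJ : J ∈ qSphere)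
    (hperp : (I * star J).re = 0) :
    ∃ F G : ℂ → ℂ,
      DifferentiableOn ℂ F (toSlice I ⁻¹' Ω) ∧ DifferentiableOn ℂ G (toSlice I ⁻¹' Ω) ∧
      ∀ z ∈ toSlice I ⁻¹' Ω, f (toSlice I z) = toSlice I (F z) + toSlice I (G z) * J := by
  let P : ℍ[ℝ] →L[ℝ] ℂ := LinearMap.toContinuousLinearMap (sliceProj I)
  let Q : ℍ[ℝ] →L[ℝ] ℂ :=
    LinearMap.toContinuousLinearMap (sliceProj I ∘ₗ LinearMap.mulRight ℝ (-J))
  refine ⟨fun z => P (f (toSlice I z)), fun z => Q (f (toSlice I z)), fun z hz => ?_,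
    fun z hz => ?_, fun z _ => toSlice_sliceProj_add_mul hI hJ hperp _⟩
  all_goals obtain ⟨D, hD, hCR⟩ := hf I hI z hz
  · exact differentiableWithinAt_comp_of_cauchyRiemann hI P (sliceProj_mul_left hI) hD hCR
  · refine differentiableWithinAt_comp_of_cauchyRiemann hI Q (fun q => ?_) hD hCR
    simpa [Q, mul_assoc] using sliceProj_mul_left hI (q * -J)
end

section
/- Let f, g : Ω → ℍ be slice regular functions on an open set Ω ⊆ ℍ. If f is a slice preserving function, then the pointwise product f·g : Ω → ℍ, q ↦ f(q)g(q), is slice regular on Ω. -/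
open scoped Quaternion

/-- Every point of the slice `L_I` commutes with `I`. -/
theorem commute_toSlice (I : ℍ[ℝ]) (w : ℂ) : Commute I (toSlice I w) := by
  unfold toSlice
  exact (Quaternion.coe_commute w.re I).symm.add_right ((Commute.refl I).smul_right w.im)

/-- The product of a slice preserving regular function with a slice regular function is
slice regular. -/
theorem slice_preserving_mul
    (Ω : Set ℍ[ℝ]) (hΩ : IsOpen Ω)
    (f g : ℍ[ℝ] → ℍ[ℝ]) (hf : SliceRegularOn f Ω) (hg : SliceRegularOn g Ω)
    (hpres : SlicePreservingOn f Ω) :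
    SliceRegularOn (fun q => f q * g q) Ω := by
  intro I hI z hz
  obtain ⟨Df, hDf, hCRf⟩ := hf I hI z hz
  obtain ⟨Dg, hDg, hCRg⟩ := hg I hI z hz
  refine ⟨_, hDf.mul' hDg, ?_⟩
  obtain ⟨w, hw⟩ := hpres I hI _ ⟨hz, z, rfl⟩
  have hcomm : I * f (toSlice I z) = f (toSlice I z) * I := hw ▸ commute_toSlice I w
  calc
    _ = f (toSlice I z) * Dg 1 + Df 1 * g (toSlice I z) +
        I * (f (toSlice I z) * Dg Complex.I + Df Complex.I * g (toSlice I z)) := rfl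
    _ = f (toSlice I z) * (Dg 1 + I * Dg Complex.I) +
        (Df 1 + I * Df Complex.I) * g (toSlice I z) := by
      rw [mul_add I, ← mul_assoc I, hcomm]
      noncomm_ring
    _ = 0 := by rw [hCRf, hCRg, mul_zero, zero_mul, add_zero]
end

section
/- Let f : Ω → Ω' ⊆ ℍ and g : Ω' → ℍ be slice regular functions on open sets Ω, Ω' ⊆ ℍ. If f is a slice preserving function, then the composition g ∘ f : Ω → ℍ is slice regular on Ω. -/
open scoped Quaternion

/-- The complex coordinate `q.re - i (I q).re` of the projection of `q` to the slice `L_I`. -/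
noncomputable def sliceCoord (I : ℍ[ℝ]) : ℍ[ℝ] →L[ℝ] ℂ :=
  LinearMap.toContinuousLinearMap
    { toFun := fun q => ⟨q.re, -(I * q).re⟩
      map_add' := fun p q => by
        apply Complex.ext
        · simp
        · simp only [mul_add, Quaternion.re_add, Complex.add_im]
          ring
      map_smul' := fun c q => by
        apply Complex.ext <;> simp [-Quaternion.re_mul] }

theorem sliceCoord_apply (I q : ℍ[ℝ]) : sliceCoord I q = ⟨q.re, -(I * q).re⟩ := rfl

theorem sliceCoord_toSlice {I : ℍ[ℝ]} (hI : I ∈ qSphere) (z : ℂ) :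
    sliceCoord I (toSlice I z) = z := by
  have hII := mul_self_of_mem_qSphere hI
  have hre : I.re = 0 := hI.1
  rw [sliceCoord_apply, toSlice, mul_add, mul_smul_comm, hII, Quaternion.mul_coe_eq_smul]
  apply Complex.ext <;> simp [hre]

theorem sliceCoord_mul {I : ℍ[ℝ]} (hI : I ∈ qSphere) (q : ℍ[ℝ]) :
    sliceCoord I (I * q) = Complex.I * sliceCoord I q := by
  have hII := mul_self_of_mem_qSphere hI
  rw [sliceCoord_apply, sliceCoord_apply, ← mul_assoc, hII]
  apply Complex.ext <;> simp [-Quaternion.re_mul]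

theorem map_add_mul_map_I_mul {I : ℍ[ℝ]} (hI : I ∈ qSphere) (E : ℂ →L[ℝ] ℍ[ℝ])
    (hE : E 1 + I * E Complex.I = 0) (a : ℂ) : E a + I * E (Complex.I * a) = 0 := by
  have hII := mul_self_of_mem_qSphere hI
  have hE' : E 1 = -(I * E Complex.I) := eq_neg_of_add_eq_zero_left hE
  have h : ∀ w : ℂ, E w = w.re • E 1 + w.im • E Complex.I := fun w => by
    rw [← map_smul, ← map_smul, ← map_add]
    congr 1
    apply Complex.ext <;> simp
  rw [h a, h (Complex.I * a), hE']
  simp only [Complex.I_mul_re, Complex.I_mul_im, mul_add, mul_smul_comm, mul_neg, ← mul_assoc, hII]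
  simp only [neg_smul, smul_neg, neg_mul, one_mul, neg_neg]
  abel

/-- The composition of a slice regular function with a slice preserving regular function is
slice regular. -/
theorem slice_preserving_comp
    (Ω Ω' : Set ℍ[ℝ]) (hΩ : IsOpen Ω) (hΩ' : IsOpen Ω')
    (f g : ℍ[ℝ] → ℍ[ℝ]) (hf : SliceRegularOn f Ω) (hmaps : Set.MapsTo f Ω Ω')
    (hg : SliceRegularOn g Ω') (hpres : SlicePreservingOn f Ω) :
    SliceRegularOn (g ∘ f) Ω := by
  intro I hI z hz
  obtain ⟨D, hD, hCR⟩ := hf I hI z hz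
  have hslice : ∀ w ∈ toSlice I ⁻¹' Ω,
      toSlice I (sliceCoord I (f (toSlice I w))) = f (toSlice I w) := fun w hw => by
    obtain ⟨v, hv⟩ := hpres I hI _ ⟨hw, w, rfl⟩
    rw [← hv, sliceCoord_toSlice hI]
  have hcoord : Set.MapsTo (fun w => sliceCoord I (f (toSlice I w)))
      (toSlice I ⁻¹' Ω) (toSlice I ⁻¹' Ω') := fun w hw => by
    rw [Set.mem_preimage, hslice w hw]
    exact hmaps hw
  obtain ⟨E, hE, hgCR⟩ := hg I hI _ (hcoord hz)
  refine ⟨E.comp ((sliceCoord I).comp D), ?_, ?_⟩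
  · have hh := (sliceCoord I).hasFDerivAt.comp_hasFDerivWithinAt z hD
    refine (HasFDerivWithinAt.comp z hE hh hcoord).congr (fun w hw => ?_) ?_
    · exact congrArg g (hslice w hw).symm
    · exact congrArg g (hslice z hz).symm
  · have hcoordCR : sliceCoord I (D 1) + Complex.I * sliceCoord I (D Complex.I) = 0 := by
      rw [← sliceCoord_mul hI, ← map_add, hCR, map_zero]
    have hmul : sliceCoord I (D Complex.I) = Complex.I * sliceCoord I (D 1) := by
      linear_combination -Complex.I * hcoordCR + sliceCoord I (D Complex.I) * Complex.I_mul_I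
    simp only [ContinuousLinearMap.comp_apply, hmul]
    exact map_add_mul_map_I_mul hI E hgCR _
end

section
/- The principal quaternionic logarithm Log, defined on ℍ \ (-∞, 0] by Log(q) = ln|q| + arccos(Re(q)/|q|) · Im(q)/|Im(q)| when Im(q) ≠ 0 and Log(x) = ln x for real x > 0, is a slice regular function on ℍ \ (-∞, 0], and it is slice preserving, i.e. Log maps (ℍ \ (-∞,0]) ∩ L_I into L_I for every I ∈ 𝕊. -/
open scoped Quaternion

theorem toSlice_re {I : ℍ[ℝ]} (hI : I ∈ qSphere) (z : ℂ) : (toSlice I z).re = z.re := by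
  simp [toSlice, hI.1]

theorem toSlice_im {I : ℍ[ℝ]} (hI : I ∈ qSphere) (z : ℂ) : (toSlice I z).im = z.im • I := by
  ext <;> simp [toSlice, hI.1]

theorem toSlice_I_mul {I : ℍ[ℝ]} (hI : I ∈ qSphere) (z : ℂ) :
    toSlice I (Complex.I * z) = I * toSlice I z := by
  simp only [toSlice, mul_add, mul_smul_comm, mul_self_of_mem_qSphere hI]
  ext <;> simp [mul_comm, add_comm]

/-- The parametrization `toSlice I` as a continuous real-linear map. -/
noncomputable def toSliceCLM (I : ℍ[ℝ]) : ℂ →L[ℝ] ℍ[ℝ] :=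
  Complex.reCLM.smulRight (1 : ℍ[ℝ]) + Complex.imCLM.smulRight I

theorem toSliceCLM_apply (I : ℍ[ℝ]) (z : ℂ) : toSliceCLM I z = toSlice I z := by
  ext <;> simp [toSliceCLM, toSlice]

theorem mem_slitPlane_of_toSlice_mem {I : ℍ[ℝ]} {z : ℂ}
    (hz : toSlice I z ∈ ((fun x : ℝ => (x : ℍ[ℝ])) '' Set.Iic 0)ᶜ) : z ∈ Complex.slitPlane := by
  rw [Complex.mem_slitPlane_iff]
  by_contra! h
  exact hz ⟨z.re, h.1, by simp [toSlice, h.2]⟩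

theorem QLog_toSlice {I : ℍ[ℝ]} (hI : I ∈ qSphere) {z : ℂ} (hz : z ∈ Complex.slitPlane) :
    QLog (toSlice I z) = toSlice I (Complex.log z) := by
  rw [QLog, norm_toSlice hI, toSlice_re hI, toSlice_im hI, toSlice, Complex.log_re, Complex.log_im,
    norm_smul, hI.2, mul_one, smul_smul, smul_smul, Real.norm_eq_abs]
  congr 2
  rcases lt_trichotomy z.im 0 with h | h | h
  · rw [Complex.arg_of_im_neg h, abs_of_neg h]
    rw [inv_neg, mul_neg, neg_mul, inv_mul_cancel_right₀ h.ne]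
  · have hre : 0 < z.re := by
      simpa [Complex.mem_slitPlane_iff, h] using hz
    simp [h, Complex.arg_eq_zero_iff.2 ⟨hre.le, h⟩]
  · rw [Complex.arg_of_im_pos h, abs_of_pos h, inv_mul_cancel_right₀ (ne_of_gt h)]

/-- The principal quaternionic logarithm is slice regular and slice preserving on
$ℍ ∖ (-∞, 0]$. -/
theorem qlog_slice_regular_and_preserving :
    SliceRegularOn QLog (((fun x : ℝ => (x : ℍ[ℝ])) '' Set.Iic 0)ᶜ) ∧
    SlicePreservingOn QLog (((fun x : ℝ => (x : ℍ[ℝ])) '' Set.Iic 0)ᶜ) := by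
  constructor
  · intro I hI z hz
    have hlog : HasFDerivAt Complex.log _ z :=
      (Complex.hasDerivAt_log (mem_slitPlane_of_toSlice_mem hz)).hasFDerivAt.restrictScalars ℝ
    refine ⟨_, (((toSliceCLM I).hasFDerivAt.comp z hlog).hasFDerivWithinAt).congr
      (fun w hw => ?_) ?_, ?_⟩
    · simpa [toSliceCLM_apply] using QLog_toSlice hI (mem_slitPlane_of_toSlice_mem hw)
    · simpa [toSliceCLM_apply] using QLog_toSlice hI (mem_slitPlane_of_toSlice_mem hz)
    · simp [toSliceCLM_apply, toSlice_I_mul hI, ← mul_assoc, mul_self_of_mem_qSphere hI]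
  · rintro I hI _ ⟨hq, z, rfl⟩
    exact ⟨Complex.log z, (QLog_toSlice hI (mem_slitPlane_of_toSlice_mem hq)).symm⟩
end
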